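/- Let R be a curvature-like tensor on ℝ^N of pure boost weight zero with respect to a null frame, i.e. every null-frame component R_{ABCD} of nonzero boost weight vanishes (the only possibly nonzero components are R_{0101}, R_{01ij}, R_{0i1j}, R_{ijkl}). Suppose that for every k ≥ 1 the bivector power R^{(k)} satisfies: (a) (1/2) R^{(k)}_{abcd} η^{ac} η^{bd} = 0; (b) R^{(k)}_{abcd} R^{(k)adcb} = 0; (c) its Ricci contraction S_{ab} = R^{(k)}_{acb}{}^{c} satisfies S_{ab} S^{ab} = 0 (all indices raised with η). Then R = 0. (Contrapositive: a nonzero curvature-like tensor of pure boost weight zero possesses a non-vanishing scalar invariant.) -/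

import Mathlib

open Matrix

/-! Null-frame formalism: we work with the components of tensors with respect to a
null frame `e_0 = ℓ, e_1 = n, e_2 = m_2, …, e_{N−1} = m_{N−1}` for the Minkowski
form `η` on `ℝ^N` (so `η(ℓ,n) = 1`, `η(m_i,m_j) = δ_{ij}`, all other frame products
vanish).  `ηnf N` is the matrix of frame components `η_{AB}`, and `ηup N = (ηnf N)⁻¹`
is the matrix of the inverse-metric components `η^{AB}` used to raise indices. -/

/-- Frame components `η_{AB}` of the Minkowski form in a null frame. -/
def ηnf (N : ℕ) : Matrix (Fin N) (Fin N) ℝ :=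
  Matrix.of fun A B =>
    if ((A : ℕ) = 0 ∧ (B : ℕ) = 1) ∨ ((A : ℕ) = 1 ∧ (B : ℕ) = 0) then 1
    else if A = B ∧ 2 ≤ (A : ℕ) then 1 else 0

/-- Components `η^{AB}` of the inverse metric in a null frame. -/
noncomputable def ηup (N : ℕ) : Matrix (Fin N) (Fin N) ℝ := (ηnf N)⁻¹

/-- The boost weight of a null-frame index: `+1` for the index `0` (the `ℓ` slot),
`−1` for the index `1` (the `n` slot), `0` for spatial indices. -/
def bw {N : ℕ} (A : Fin N) : ℤ :=
  if (A : ℕ) = 0 then 1 else if (A : ℕ) = 1 then -1 else 0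

/-- A curvature-like tensor: a 4-linear form (given here by its null-frame components)
with `R_{abcd} = −R_{bacd} = R_{cdab}`. -/
def CurvLike {N : ℕ} (R : Fin N → Fin N → Fin N → Fin N → ℝ) : Prop :=
  (∀ a b c d, R a b c d = -R b a c d) ∧ (∀ a b c d, R a b c d = R c d a b)

/-- Bivector powers of a curvature-like tensor: `bivPow N R k = R^{(k+1)}`, where
`R^{(1)} = R` and `R^{(k+1)}_{abcd} = (1/2) R^{(k)}_{abef} η^{eg} η^{fh} R_{ghcd}`. -/
noncomputable def bivPow (N : ℕ) (R : Fin N → Fin N → Fin N → Fin N → ℝ) :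
    ℕ → (Fin N → Fin N → Fin N → Fin N → ℝ)
  | 0 => R
  | k + 1 => fun a b c d =>
      (1 / 2 : ℝ) * ∑ e, ∑ f, ∑ g, ∑ h,
        bivPow N R k a b e f * ηup N e g * ηup N f h * R g h c d

open Polynomial in
theorem LinearMap.isNilpotent_of_trace_pow_eq_zero {K V : Type*} [Field K] [CharZero K]
    [AddCommGroup V] [Module K V] [FiniteDimensional K V] (f : Module.End K V)
    (h : ∀ k : ℕ, LinearMap.trace K V (f ^ (k + 1)) = 0) : IsNilpotent f := by
  have h_trace : ∀ p : K[X], LinearMap.trace K V (aeval f (p * X)) = 0 := by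
    intro p
    induction p using Polynomial.induction_on' with
    | add p q hp hq => rw [add_mul, map_add, map_add, hp, hq, add_zero]
    | monomial k a =>
      rw [monomial_mul_X, aeval_monomial, ← Algebra.smul_def, map_smul, h, smul_zero]
  obtain ⟨q, hq, hXq⟩ := exists_eq_pow_rootMultiplicity_mul_and_not_dvd f.charpoly
    f.charpoly_monic.ne_zero 0
  set m := rootMultiplicity 0 f.charpoly
  rw [C_0, sub_zero] at hq hXq
  obtain ⟨a, b, hab⟩ : IsCoprime (X ^ (m + 1)) q :=
    ((prime_X.coprime_iff_not_dvd).2 hXq).pow_left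
  have h_zero : aeval f (X ^ m * q) = 0 := hq ▸ f.aeval_self_charpoly
  have h_idem : IsIdempotentElem (aeval f (a * X ^ m * X)) := by
    have h_split : a * X ^ m * X = a * X ^ m * X * (a * X ^ m * X) + X ^ m * q * (a * b * X) := by
      linear_combination (-(a * X ^ m * X)) * hab
    have := congrArg (aeval f) h_split
    rw [map_add, map_mul (aeval f) (X ^ m * q), h_zero, zero_mul, add_zero, map_mul (aeval f)
      (a * X ^ m * X)] at this
    exact this.symm
  have h_e := LinearMap.IsIdempotentElem.eq_zero_of_trace_eq_zero h_idem (h_trace _)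
  refine ⟨m, ?_⟩
  have h_split : (X : K[X]) ^ m = a * X ^ m * X * X ^ m + X ^ m * q * b := by
    linear_combination (-(X : K[X]) ^ m) * hab
  have := congrArg (aeval f) h_split
  rwa [map_add, map_mul (aeval f) (X ^ m * q), h_zero, zero_mul, map_mul (aeval f)
    (a * X ^ m * X), h_e, zero_mul, add_zero, map_pow, aeval_X] at this

theorem Matrix.isNilpotent_of_trace_pow_eq_zero {K n : Type*} [Field K] [CharZero K]
    [Fintype n] [DecidableEq n] (M : Matrix n n K) (h : ∀ k : ℕ, (M ^ (k + 1)).trace = 0) :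
    IsNilpotent M := by
  refine (IsNilpotent.map_iff (Matrix.toLinAlgEquiv' (R := K) (n := n)).injective).1
    (LinearMap.isNilpotent_of_trace_pow_eq_zero _ fun k => ?_)
  rw [← map_pow]
  exact (Matrix.trace_toLin'_eq _).trans (h k)

/-- The involution exchanging the two null indices. -/
def nullSwap (n : ℕ) : Equiv.Perm (Fin (n + 2)) := Equiv.swap 0 1

theorem nullSwap_zero (n : ℕ) : nullSwap n 0 = 1 := Equiv.swap_apply_left _ _

theorem nullSwap_one (n : ℕ) : nullSwap n 1 = 0 := Equiv.swap_apply_right _ _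

theorem nullSwap_succ_succ {n : ℕ} (i : Fin n) : nullSwap n i.succ.succ = i.succ.succ := by
  apply Equiv.swap_apply_of_ne_of_ne <;> simp [Fin.ext_iff]

theorem nullSwap_nullSwap {n : ℕ} (a : Fin (n + 2)) : nullSwap n (nullSwap n a) = a :=
  Equiv.swap_apply_self _ _ _

theorem Fin.cases_zero_one {n : ℕ} {P : Fin (n + 2) → Prop} (h0 : P 0) (h1 : P 1)
    (h2 : ∀ i : Fin n, P i.succ.succ) (a : Fin (n + 2)) : P a :=
  Fin.cases h0 (Fin.cases h1 h2) a

theorem ηnf_apply (n : ℕ) (a b : Fin (n + 2)) :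
    ηnf (n + 2) a b = if nullSwap n a = b then 1 else 0 := by
  induction a using Fin.cases_zero_one <;> induction b using Fin.cases_zero_one <;>
    simp only [ηnf, Matrix.of_apply, nullSwap_zero, nullSwap_one, nullSwap_succ_succ,
      Fin.ext_iff] <;> simp

theorem ηnf_mul_self (n : ℕ) : ηnf (n + 2) * ηnf (n + 2) = 1 := by
  ext a b
  rw [Matrix.mul_apply, Finset.sum_eq_single (nullSwap n a)]
  · simp [ηnf_apply, nullSwap_nullSwap, Matrix.one_apply]
  · intro c _ hc
    simp [ηnf_apply, hc.symm]
  · simp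

theorem ηup_apply (n : ℕ) (a b : Fin (n + 2)) :
    ηup (n + 2) a b = if nullSwap n a = b then 1 else 0 := by
  rw [ηup, Matrix.inv_eq_left_inv (ηnf_mul_self n), ηnf_apply]

theorem bw_zero (n : ℕ) : bw (0 : Fin (n + 2)) = 1 := by simp [bw]

theorem bw_one (n : ℕ) : bw (1 : Fin (n + 2)) = -1 := by simp [bw]

theorem bw_succ_succ {n : ℕ} (i : Fin n) : bw i.succ.succ = 0 := by simp [bw]

theorem bw_nullSwap {n : ℕ} (a : Fin (n + 2)) : bw (nullSwap n a) = -bw a := by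
  induction a using Fin.cases_zero_one <;>
    simp [nullSwap_zero, nullSwap_one, nullSwap_succ_succ, bw_zero, bw_one, bw_succ_succ]

theorem bivPow_succ (n : ℕ) (R : Fin (n + 2) → Fin (n + 2) → Fin (n + 2) → Fin (n + 2) → ℝ)
    (k : ℕ) (a b c d : Fin (n + 2)) :
    bivPow (n + 2) R (k + 1) a b c d = (1 / 2 : ℝ) * ∑ e, ∑ f,
      bivPow (n + 2) R k a b e f * R (nullSwap n e) (nullSwap n f) c d := by
  simp [bivPow, ηup_apply]

/-- The mixed-index matrix on index pairs: `½ R^{ab}{}_{cd}`. -/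
noncomputable def bivMatrix (n : ℕ)
    (R : Fin (n + 2) → Fin (n + 2) → Fin (n + 2) → Fin (n + 2) → ℝ) :
    Matrix (Fin (n + 2) × Fin (n + 2)) (Fin (n + 2) × Fin (n + 2)) ℝ :=
  Matrix.of fun p q => (1 / 2 : ℝ) * R (nullSwap n p.1) (nullSwap n p.2) q.1 q.2

theorem bivMatrix_bivPow (n : ℕ) (R : Fin (n + 2) → Fin (n + 2) → Fin (n + 2) → Fin (n + 2) → ℝ)
    (k : ℕ) : bivMatrix n (bivPow (n + 2) R k) = bivMatrix n R ^ (k + 1) := by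
  induction k with
  | zero => simp [bivPow]
  | succ k ih =>
    rw [pow_succ, ← ih]
    ext p q
    simp only [bivMatrix, bivPow_succ, Matrix.mul_apply, Matrix.of_apply, Fintype.sum_prod_type,
      Finset.mul_sum]
    refine Finset.sum_congr rfl fun e _ => Finset.sum_congr rfl fun f _ => ?_
    ring

theorem bivMatrix_eq_zero_iff {n : ℕ}
    {R : Fin (n + 2) → Fin (n + 2) → Fin (n + 2) → Fin (n + 2) → ℝ} :
    bivMatrix n R = 0 ↔ ∀ a b c d, R a b c d = 0 := by
  refine ⟨fun h a b c d => ?_, fun h => by ext; simp [bivMatrix, h]⟩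
  have := congrFun (congrFun h (nullSwap n a, nullSwap n b)) (c, d)
  simpa [bivMatrix, nullSwap_nullSwap] using this

theorem trace_bivMatrix (n : ℕ) (R : Fin (n + 2) → Fin (n + 2) → Fin (n + 2) → Fin (n + 2) → ℝ) :
    (bivMatrix n R).trace = (1 / 2 : ℝ) * ∑ a, ∑ b, R a b (nullSwap n a) (nullSwap n b) := by
  simp only [Matrix.trace, Matrix.diag, bivMatrix, Matrix.of_apply, Fintype.sum_prod_type,
    ← Finset.mul_sum]
  congr 1
  rw [← Equiv.sum_comp (nullSwap n)]
  refine Finset.sum_congr rfl fun a _ => ?_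
  rw [← Equiv.sum_comp (nullSwap n)]
  simp [nullSwap_nullSwap]

/-- Vanishing of all components of nonzero boost weight. -/
def IsBoostWeightZero {N : ℕ} (R : Fin N → Fin N → Fin N → Fin N → ℝ) : Prop :=
  ∀ a b c d : Fin N, bw a + bw b + bw c + bw d ≠ 0 → R a b c d = 0

theorem IsBoostWeightZero.bivPow {n : ℕ}
    {R : Fin (n + 2) → Fin (n + 2) → Fin (n + 2) → Fin (n + 2) → ℝ} (h : IsBoostWeightZero R)
    (k : ℕ) : IsBoostWeightZero (bivPow (n + 2) R k) := by
  induction k with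
  | zero => exact h
  | succ k ih =>
    intro a b c d h_ne
    rw [bivPow_succ]
    simp only [mul_eq_zero]
    refine Or.inr (Finset.sum_eq_zero fun e _ => Finset.sum_eq_zero fun f _ => ?_)
    by_cases h_left : bw a + bw b + bw e + bw f = 0
    · rw [h (nullSwap n e) (nullSwap n f) c d, mul_zero]
      rw [bw_nullSwap, bw_nullSwap]
      omega
    · rw [ih a b e f h_left, zero_mul]

theorem CurvLike.bivPow {n : ℕ}
    {R : Fin (n + 2) → Fin (n + 2) → Fin (n + 2) → Fin (n + 2) → ℝ} (h : CurvLike R)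
    (k : ℕ) : CurvLike (bivPow (n + 2) R k) := by
  have h_antisymm : ∀ k a b c d, _root_.bivPow (n + 2) R k a b c d =
      -_root_.bivPow (n + 2) R k b a c d := by
    intro k
    induction k with
    | zero => exact h.1
    | succ k ih =>
      intro a b c d
      simp only [bivPow_succ, ih a b, neg_mul, Finset.sum_neg_distrib, mul_neg]
  have h_left : ∀ k a b c d, _root_.bivPow (n + 2) R (k + 1) a b c d = (1 / 2 : ℝ) * ∑ e, ∑ f,
      R a b e f * _root_.bivPow (n + 2) R k (nullSwap n e) (nullSwap n f) c d := by
    intro k a b c d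
    have := congrFun (congrFun (bivMatrix_bivPow n R (k + 1)) (nullSwap n a, nullSwap n b)) (c, d)
    rw [pow_succ', ← bivMatrix_bivPow] at this
    simp only [bivMatrix, Matrix.mul_apply, Matrix.of_apply, Fintype.sum_prod_type,
      nullSwap_nullSwap] at this
    rw [← mul_right_inj' (one_div_ne_zero (two_ne_zero' ℝ)), this]
    simp only [Finset.mul_sum]
    refine Finset.sum_congr rfl fun e _ => Finset.sum_congr rfl fun f _ => ?_
    ring
  refine ⟨h_antisymm k, ?_⟩
  induction k with
  | zero => exact h.2
  | succ k ih =>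
    intro a b c d
    rw [h_left, bivPow_succ]
    congr 1
    rw [← Equiv.sum_comp (nullSwap n)]
    refine Finset.sum_congr rfl fun e _ => ?_
    rw [← Equiv.sum_comp (nullSwap n)]
    refine Finset.sum_congr rfl fun f _ => ?_
    rw [nullSwap_nullSwap, nullSwap_nullSwap, ih e f c d, h.2 a b, mul_comm]

theorem Fin.sum_zero_one {n : ℕ} (f : Fin (n + 2) → ℝ) :
    ∑ a, f a = f 0 + f 1 + ∑ i : Fin n, f i.succ.succ := by
  rw [Fin.sum_univ_succ, Fin.sum_univ_succ, ← add_assoc]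
  rfl

theorem eq_zero_of_sum_sum_mul_self_eq_zero {ι κ : Type*} [Fintype ι] [Fintype κ]
    {f : ι → κ → ℝ} (h : ∑ i, ∑ j, f i j * f i j = 0) (i : ι) (j : κ) : f i j = 0 := by
  have h_row := (Finset.sum_eq_zero_iff_of_nonneg fun i _ =>
    Finset.sum_nonneg fun j _ => mul_self_nonneg (f i j)).1 h i (Finset.mem_univ i)
  exact mul_self_eq_zero.1 ((Finset.sum_eq_zero_iff_of_nonneg fun j _ =>
    mul_self_nonneg (f i j)).1 h_row j (Finset.mem_univ j))

theorem CurvLike.eq_zero_of_components {n : ℕ}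
    {Q : Fin (n + 2) → Fin (n + 2) → Fin (n + 2) → Fin (n + 2) → ℝ}
    (h_curv : CurvLike Q) (h_bw : IsBoostWeightZero Q) (h_null : Q 0 1 0 1 = 0)
    (h_mixed : ∀ i j : Fin n, Q 0 1 i.succ.succ j.succ.succ = 0)
    (h_cross : ∀ i j : Fin n, Q 0 i.succ.succ 1 j.succ.succ = 0)
    (h_spatial : ∀ i j k l : Fin n,
      Q i.succ.succ j.succ.succ k.succ.succ l.succ.succ = 0) :
    ∀ a b c d, Q a b c d = 0 := by
  have h_left := h_curv.1
  have h_pair := h_curv.2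
  intro a b c d
  by_cases h_ne : bw a + bw b + bw c + bw d = 0
  swap
  · exact h_bw a b c d h_ne
  induction a using Fin.cases_zero_one <;> induction b using Fin.cases_zero_one <;>
    induction c using Fin.cases_zero_one <;> induction d using Fin.cases_zero_one <;>
    first
    | simp [bw_zero, bw_one, bw_succ_succ] at h_ne; done
    | grind

theorem CurvLike.eq_zero_of_sq_eq_zero {n : ℕ}
    {Q : Fin (n + 2) → Fin (n + 2) → Fin (n + 2) → Fin (n + 2) → ℝ}
    (h_curv : CurvLike Q) (h_bw : IsBoostWeightZero Q)
    (h_sq : ∀ a b c d, ∑ e, ∑ f, Q a b e f * Q (nullSwap n e) (nullSwap n f) c d = 0)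
    (h_trans : ∑ a, ∑ b, ∑ c, ∑ d,
      Q a b c d * Q (nullSwap n a) (nullSwap n d) (nullSwap n c) (nullSwap n b) = 0)
    (h_ricci : ∑ a, ∑ b, (∑ c, Q a c b (nullSwap n c)) *
      (∑ c, Q (nullSwap n a) c (nullSwap n b) (nullSwap n c)) = 0) :
    ∀ a b c d, Q a b c d = 0 := by
  have h_left := h_curv.1
  have h_pair := h_curv.2
  have h_right : ∀ a b c d, Q a b c d = -Q a b d c := fun a b c d => by
    rw [h_pair, h_left, h_pair]
  have h_diag : ∀ a c d, Q a a c d = 0 := fun a c d => by linarith [h_left a a c d]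
  have h_diag' : ∀ a c d, Q c d a a = 0 := fun a c d => by linarith [h_right c d a a]
  have h_cross_sq : ∀ i j : Fin n,
      ∑ k : Fin n, Q 0 i.succ.succ 1 k.succ.succ * Q 0 k.succ.succ 1 j.succ.succ = 0 := by
    intro i j
    have h := h_sq 0 i.succ.succ 1 j.succ.succ
    simp only [Fin.sum_zero_one, nullSwap_zero, nullSwap_one, nullSwap_succ_succ] at h
    simp (disch := simp [bw_zero, bw_one, bw_succ_succ]) only [h_bw 0 _ 0, h_bw 0 _ _ 0,
      h_bw 0 _ (Fin.succ _) (Fin.succ _), h_bw 0 _ 1 1] at h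
    simp only [zero_mul, zero_add, add_zero, Finset.sum_const_zero] at h
    rw [← add_self_eq_zero, ← h]
    congr 1
    refine Finset.sum_congr rfl fun k _ => ?_
    rw [h_right 0 _ _ 1, h_left _ 0, neg_mul_neg]
  have h_trace : ∑ i : Fin n, Q 0 i.succ.succ 1 i.succ.succ = 0 := by
    let Ω : Matrix (Fin n) (Fin n) ℝ := Matrix.of fun i j => Q 0 i.succ.succ 1 j.succ.succ
    have h_nil : IsNilpotent Ω := ⟨2, by
      ext i j
      simpa [sq, Ω, Matrix.mul_apply] using h_cross_sq i j⟩
    exact (Matrix.isNilpotent_trace_of_isNilpotent h_nil).eq_zero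
  have h_null : Q 0 1 0 1 = 0 := by
    set S : Fin (n + 2) → Fin (n + 2) → ℝ := fun a b => ∑ c, Q a c b (nullSwap n c) with hS
    have h_S_bw : ∀ a b, bw a + bw b ≠ 0 → S a b = 0 := fun a b h =>
      Finset.sum_eq_zero fun c _ => h_bw _ _ _ _ (by rw [bw_nullSwap]; omega)
    have h_S01 : S 0 1 = -Q 0 1 0 1 := by
      simp only [hS, Fin.sum_zero_one, nullSwap_zero, nullSwap_one, nullSwap_succ_succ, h_trace,
        h_diag, add_zero, zero_add]
      exact h_right _ _ _ _
    have h_S10 : S 1 0 = -Q 0 1 0 1 := by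
      simp only [hS, Fin.sum_zero_one, nullSwap_zero, nullSwap_one, nullSwap_succ_succ,
        h_pair 1 (Fin.succ _), h_trace, h_diag, add_zero]
      exact h_left _ _ _ _
    change ∑ a, ∑ b, S a b * S (nullSwap n a) (nullSwap n b) = 0 at h_ricci
    simp only [Fin.sum_zero_one, nullSwap_zero, nullSwap_one, nullSwap_succ_succ] at h_ricci
    simp (disch := simp [bw_zero, bw_one, bw_succ_succ]) only [h_S_bw 0 0, h_S_bw 0 (Fin.succ _),
      h_S_bw 1 (Fin.succ _), h_S_bw (Fin.succ _) 0, h_S_bw (Fin.succ _) 1, h_S01, h_S10] at h_ricci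
    simp only [zero_mul, zero_add, add_zero, Finset.sum_const_zero] at h_ricci
    have h_nonneg : 0 ≤ ∑ i : Fin n, ∑ j : Fin n,
        S i.succ.succ j.succ.succ * S i.succ.succ j.succ.succ :=
      Finset.sum_nonneg fun i _ => Finset.sum_nonneg fun j _ => mul_self_nonneg _
    nlinarith [mul_self_nonneg (Q 0 1 0 1)]
  have h_mixed : ∀ i j : Fin n, Q 0 1 i.succ.succ j.succ.succ = 0 := by
    intro i j
    have h := h_sq 0 1 0 1
    simp only [Fin.sum_zero_one, nullSwap_zero, nullSwap_one, nullSwap_succ_succ] at h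
    simp (disch := simp [bw_zero, bw_one, bw_succ_succ]) only [h_diag, h_diag', h_null,
      h_right 0 1 1 0, h_bw 0 1 0 (Fin.succ _), h_bw 0 1 1 (Fin.succ _), h_bw 0 1 (Fin.succ _) 0,
      h_bw 0 1 (Fin.succ _) 1, h_pair (Fin.succ _) (Fin.succ _) 0 1] at h
    simp only [zero_mul, neg_zero, zero_add, add_zero, Finset.sum_const_zero] at h
    exact eq_zero_of_sum_sum_mul_self_eq_zero h i j
  have h_spatial : ∀ i j k l : Fin n,
      Q i.succ.succ j.succ.succ k.succ.succ l.succ.succ = 0 := by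
    intro i j k l
    have h := h_sq i.succ.succ j.succ.succ i.succ.succ j.succ.succ
    simp only [Fin.sum_zero_one, nullSwap_zero, nullSwap_one, nullSwap_succ_succ] at h
    simp (disch := simp [bw_zero, bw_one, bw_succ_succ]) only [h_diag, h_diag',
      h_right (Fin.succ _) (Fin.succ _) 1 0, h_pair (Fin.succ _) (Fin.succ _) 0 1, h_mixed,
      h_bw (Fin.succ _) (Fin.succ _) 0 (Fin.succ _), h_bw (Fin.succ _) (Fin.succ _) 1 (Fin.succ _),
      h_bw (Fin.succ _) (Fin.succ _) (Fin.succ _) 0,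
      h_bw (Fin.succ _) (Fin.succ _) (Fin.succ _) 1] at h
    simp only [zero_mul, neg_zero, zero_add, add_zero, Finset.sum_const_zero] at h
    refine eq_zero_of_sum_sum_mul_self_eq_zero (ι := Fin n) (κ := Fin n)
      (f := fun k l => Q i.succ.succ j.succ.succ k.succ.succ l.succ.succ) ?_ k l
    rw [← h]
    refine Finset.sum_congr rfl fun k _ => Finset.sum_congr rfl fun l _ => ?_
    rw [h_pair k.succ.succ]
  refine h_curv.eq_zero_of_components h_bw h_null h_mixed ?_ h_spatial
  have h_term : ∀ a b c d,
      0 ≤ Q a b c d * Q (nullSwap n a) (nullSwap n d) (nullSwap n c) (nullSwap n b) := by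
    intro a b c d
    by_cases h_ne : bw a + bw b + bw c + bw d = 0
    swap
    · rw [h_bw a b c d h_ne, zero_mul]
    have h_mixed' : ∀ i j : Fin n, Q 1 0 i.succ.succ j.succ.succ = 0 := fun i j => by
      rw [h_left, h_mixed, neg_zero]
    induction a using Fin.cases_zero_one <;> induction b using Fin.cases_zero_one <;>
      induction c using Fin.cases_zero_one <;> induction d using Fin.cases_zero_one <;>
      simp only [nullSwap_zero, nullSwap_one, nullSwap_succ_succ] <;>
      first
      | simp [bw_zero, bw_one, bw_succ_succ] at h_ne; done
      | simp [h_diag, h_null, h_mixed, h_mixed', h_spatial, h_pair (Fin.succ _) (Fin.succ _)]; done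
      | rw [h_pair]; exact mul_self_nonneg _
  intro i j
  have h_nonneg₁ := fun a b c => Finset.sum_nonneg fun d (_ : d ∈ Finset.univ) => h_term a b c d
  have h_nonneg₂ := fun a b => Finset.sum_nonneg fun c (_ : c ∈ Finset.univ) => h_nonneg₁ a b c
  have h_nonneg₃ := fun a => Finset.sum_nonneg fun b (_ : b ∈ Finset.univ) => h_nonneg₂ a b
  have h := (Finset.sum_eq_zero_iff_of_nonneg fun a _ => h_nonneg₃ a).1 h_trans 0
    (Finset.mem_univ _)
  replace h := (Finset.sum_eq_zero_iff_of_nonneg fun b _ => h_nonneg₂ 0 b).1 h i.succ.succ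
    (Finset.mem_univ _)
  replace h := (Finset.sum_eq_zero_iff_of_nonneg fun c _ => h_nonneg₁ 0 i.succ.succ c).1 h 1
    (Finset.mem_univ _)
  replace h := (Finset.sum_eq_zero_iff_of_nonneg fun d _ => h_term 0 i.succ.succ 1 d).1 h
    j.succ.succ (Finset.mem_univ _)
  rw [nullSwap_zero, nullSwap_one, nullSwap_succ_succ, nullSwap_succ_succ, h_pair 1] at h
  exact mul_self_eq_zero.1 h

/-- **Lemma 7** (`lem:pwzero`): a curvature-like tensor of pure boost weight zero all
of whose zeroth-order invariants vanish — in particular, for every `k ≥ 1`,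
(a) `(1/2) R^{(k)}_{abcd} η^{ac} η^{bd} = 0`, (b) `R^{(k)}_{abcd} R^{(k)adcb} = 0`, and
(c) its Ricci contraction `S_{ab} = R^{(k)}_{acb}{}^c` satisfies `S_{ab}S^{ab} = 0` —
must vanish.  (Contrapositive: a nonzero curvature-like tensor of pure boost weight
zero possesses a non-vanishing scalar invariant.) -/
theorem pure_boost_weight_zero_vsi (N : ℕ) (hN : 2 ≤ N)
    (R : Fin N → Fin N → Fin N → Fin N → ℝ) (hcurv : CurvLike R)
    (hbw : ∀ a b c d : Fin N, bw a + bw b + bw c + bw d ≠ 0 → R a b c d = 0)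
    (ha : ∀ k : ℕ,
      (1 / 2 : ℝ) * (∑ a, ∑ b, ∑ c, ∑ d,
        bivPow N R k a b c d * ηup N a c * ηup N b d) = 0)
    (hb : ∀ k : ℕ,
      (∑ a, ∑ b, ∑ c, ∑ d, ∑ a', ∑ b', ∑ c', ∑ d',
        bivPow N R k a b c d * ηup N a a' * ηup N b b' * ηup N c c' * ηup N d d' *
          bivPow N R k a' d' c' b') = 0)
    (hc : ∀ k : ℕ,
      (∑ a, ∑ b, ∑ a', ∑ b',
        (∑ c, ∑ c', bivPow N R k a c b c' * ηup N c c') * ηup N a a' * ηup N b b' *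
          (∑ c, ∑ c', bivPow N R k a' c b' c' * ηup N c c')) = 0) :
    ∀ a b c d, R a b c d = 0 := by
  obtain ⟨n, rfl⟩ := Nat.exists_eq_add_of_le' hN
  have h_nil : IsNilpotent (bivMatrix n R) := by
    refine Matrix.isNilpotent_of_trace_pow_eq_zero _ fun k => ?_
    rw [← bivMatrix_bivPow, trace_bivMatrix]
    simpa [ηup_apply] using ha k
  by_contra h_ne
  have h_exists : ∃ k, bivMatrix n R ^ (k + 1) = 0 := by
    obtain ⟨k, hk⟩ := h_nil
    exact ⟨k, by rw [pow_succ, hk, zero_mul]⟩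
  classical
  obtain ⟨k, hk⟩ : ∃ k, Nat.find h_exists = k + 1 := by
    refine Nat.exists_eq_succ_of_ne_zero fun h0 => h_ne ?_
    have := Nat.find_spec h_exists
    rw [h0, zero_add, pow_one] at this
    exact bivMatrix_eq_zero_iff.1 this
  refine Nat.find_min h_exists (m := k) (by omega) ?_
  rw [← bivMatrix_bivPow, bivMatrix_eq_zero_iff]
  refine (hcurv.bivPow k).eq_zero_of_sq_eq_zero (IsBoostWeightZero.bivPow hbw k) ?_ ?_ ?_
  · have h_sq : bivMatrix n (bivPow (n + 2) R k) * bivMatrix n (bivPow (n + 2) R k) = 0 := by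
      rw [bivMatrix_bivPow, ← pow_add]
      have := Nat.find_spec h_exists
      rw [hk] at this
      exact pow_eq_zero_of_le (by omega) this
    intro a b c d
    have h := congrFun (congrFun h_sq (nullSwap n a, nullSwap n b)) (c, d)
    simp only [bivMatrix, Matrix.mul_apply, Matrix.of_apply, Fintype.sum_prod_type,
      nullSwap_nullSwap, Matrix.zero_apply] at h
    rw [← mul_zero (4 : ℝ), ← h, Finset.mul_sum]
    refine Finset.sum_congr rfl fun e _ => ?_
    rw [Finset.mul_sum]
    refine Finset.sum_congr rfl fun f _ => ?_
    ring
  · simpa [ηup_apply] using hb k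
  · simpa [ηup_apply] using hc k
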